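/- arXiv:1905.06494 — 2 statements merged into one kernel-verified Lean document; each statement's English description precedes it below -/
import Mathlib

section
/- (Convexity of the Thompson Sampling attack constraint set.) Fix K ≥ 2, a target index a* ∈ {1,…,K}, positive integers m_1,…,m_K, vectors y_a ∈ ℝ^{m_a}, reals σ > 0 and δ > 0. For a collection of vectors ε = (ε_a)_{a=1}^{K} with ε_a ∈ ℝ^{m_a}, write μ̃_a(ε) = (1/m_a) Σ_{i=1}^{m_a} (y_{a,i} + ε_{a,i}). Then the set S = { ε : Σ_{a ≠ a*} Φ( (μ̃_a(ε) − μ̃_{a*}(ε)) / (σ³·√(1/m_a + 1/m_{a*})) ) ≤ δ and μ̃_a(ε) − μ̃_{a*}(ε) ≤ 0 for all a ≠ a* } is a convex subset of the product space ℝ^{m_1} × ⋯ × ℝ^{m_K}. -/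
open MeasureTheory Real Finset

/-- The standard normal cumulative distribution function. -/
noncomputable def stdNormalCDF (z : ℝ) : ℝ :=
  ∫ x in Set.Iic z, (Real.sqrt (2 * Real.pi))⁻¹ * Real.exp (-x ^ 2 / 2)

theorem stdNormalCDF_hasDerivAt (z : ℝ) : HasDerivAt stdNormalCDF
    ((Real.sqrt (2 * Real.pi))⁻¹ * Real.exp (-z ^ 2 / 2)) z := by
  have hc : Continuous fun x : ℝ => (Real.sqrt (2 * Real.pi))⁻¹ * Real.exp (-x ^ 2 / 2) := by
    fun_prop
  have hi : Integrable fun x : ℝ => (Real.sqrt (2 * Real.pi))⁻¹ * Real.exp (-x ^ 2 / 2) := by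
    have h := (integrable_exp_neg_mul_sq (b := 1 / 2) (by norm_num)).const_mul
      (Real.sqrt (2 * Real.pi))⁻¹
    refine h.congr (Filter.Eventually.of_forall fun x => ?_)
    have hx : -(1 / 2) * x ^ 2 = -x ^ 2 / 2 := by ring
    simp only [hx]
  have he : stdNormalCDF = fun z => stdNormalCDF 0 +
      ∫ x in (0 : ℝ)..z, (Real.sqrt (2 * Real.pi))⁻¹ * Real.exp (-x ^ 2 / 2) := by
    funext w
    have := intervalIntegral.integral_Iic_sub_Iic (a := 0) (b := w)
      hi.integrableOn hi.integrableOn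
    rw [← this]
    simp only [stdNormalCDF]
    ring
  rw [he]
  exact (intervalIntegral.integral_hasDerivAt_right (hc.intervalIntegrable _ _)
    (hc.stronglyMeasurableAtFilter _ _) hc.continuousAt).const_add _

theorem stdNormalCDF_convexOn : ConvexOn ℝ (Set.Iic 0) stdNormalCDF := by
  have hd : Differentiable ℝ stdNormalCDF := fun z => (stdNormalCDF_hasDerivAt z).differentiableAt
  refine MonotoneOn.convexOn_of_deriv (convex_Iic 0) hd.continuous.continuousOn
    hd.differentiableOn ?_
  intro x hx z hz hxz
  rw [interior_Iic] at hx hz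
  rw [(stdNormalCDF_hasDerivAt x).deriv, (stdNormalCDF_hasDerivAt z).deriv]
  have hx' : x < 0 := hx
  have hz' : z < 0 := hz
  apply mul_le_mul_of_nonneg_left _ (by positivity)
  apply Real.exp_le_exp.mpr
  nlinarith

/-- The constraint set of the Thompson-Sampling offline attack program `P₃` is convex. -/
theorem stmt3 (K : ℕ) (hK : 2 ≤ K) (astar : Fin K) (m : Fin K → ℕ) (hm : ∀ a, 0 < m a)
    (y : (a : Fin K) → Fin (m a) → ℝ) (σ δ : ℝ) (hσ : 0 < σ) (hδ : 0 < δ)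
    (tmu : ((a : Fin K) → Fin (m a) → ℝ) → Fin K → ℝ)
    (htmu : ∀ ε a, tmu ε a = (1 / (m a : ℝ)) * ∑ i : Fin (m a), (y a i + ε a i)) :
    Convex ℝ {ε : (a : Fin K) → Fin (m a) → ℝ |
      (∑ a ∈ univ.erase astar,
          stdNormalCDF ((tmu ε a - tmu ε astar)
            / (σ ^ 3 * Real.sqrt (1 / (m a : ℝ) + 1 / (m astar : ℝ)))) ≤ δ) ∧
      ∀ a ≠ astar, tmu ε a - tmu ε astar ≤ 0} := by
  have haff : ∀ (u v : (a : Fin K) → Fin (m a) → ℝ) (s t : ℝ), s + t = 1 → ∀ a,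
      tmu (s • u + t • v) a = s * tmu u a + t * tmu v a := by
    intro u v s t hst a
    simp only [htmu]
    have : ∀ i, y a i + (s • u + t • v) a i = s * (y a i + u a i) + t * (y a i + v a i) := by
      intro i
      simp only [Pi.add_apply, Pi.smul_apply, smul_eq_mul]
      linear_combination (-(y a i)) * hst
    simp only [this, Finset.sum_add_distrib (f := fun i => s * (y a i + u a i)),
      ← Finset.mul_sum]
    ring
  intro u hu v hv s t hs ht hst
  obtain ⟨hu1, hu2⟩ := hu
  obtain ⟨hv1, hv2⟩ := hv
  refine ⟨?_, ?_⟩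
  · have key : ∀ a ∈ univ.erase astar,
        stdNormalCDF ((tmu (s • u + t • v) a - tmu (s • u + t • v) astar)
            / (σ ^ 3 * Real.sqrt (1 / (m a : ℝ) + 1 / (m astar : ℝ)))) ≤
        s * stdNormalCDF ((tmu u a - tmu u astar)
            / (σ ^ 3 * Real.sqrt (1 / (m a : ℝ) + 1 / (m astar : ℝ)))) +
        t * stdNormalCDF ((tmu v a - tmu v astar)
            / (σ ^ 3 * Real.sqrt (1 / (m a : ℝ) + 1 / (m astar : ℝ)))) := by
      intro a ha
      have hne := (Finset.mem_erase.mp ha).1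
      have hc : 0 ≤ σ ^ 3 * Real.sqrt (1 / (m a : ℝ) + 1 / (m astar : ℝ)) := by positivity
      have h := stdNormalCDF_convexOn.2
        (Set.mem_Iic.mpr (div_nonpos_of_nonpos_of_nonneg (hu2 a hne) hc))
        (Set.mem_Iic.mpr (div_nonpos_of_nonpos_of_nonneg (hv2 a hne) hc)) hs ht hst
      simp only [smul_eq_mul] at h
      refine le_trans (le_of_eq ?_) h
      congr 1
      rw [haff u v s t hst, haff u v s t hst]
      ring
    refine (Finset.sum_le_sum key).trans ?_
    rw [Finset.sum_add_distrib, ← Finset.mul_sum, ← Finset.mul_sum]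
    calc _ ≤ s * δ + t * δ := add_le_add (mul_le_mul_of_nonneg_left hu1 hs)
          (mul_le_mul_of_nonneg_left hv1 ht)
      _ = δ := by rw [← add_mul, hst, one_mul]
  · intro a ha
    rw [haff u v s t hst, haff u v s t hst]
    nlinarith [mul_nonneg hs (sub_nonneg.mpr (hu2 a ha)), mul_nonneg ht (sub_nonneg.mpr (hv2 a ha))]
end

section
/- (Union bound on the probability that the target Gaussian coordinate is not the largest.) Let A be a finite index set with |A| ≥ 2, fix a* ∈ A, and for each a ∈ A let ν_a ∈ ℝ and s_a > 0. Let P = ⊗_{a ∈ A} N(ν_a, s_a²) be the product Gaussian measure on ℝ^A. Then P({ θ ∈ ℝ^A : there exists a ≠ a* with θ_{a*} < θ_a }) ≤ Σ_{a ≠ a*} Φ( (ν_a − ν_{a*}) / √(s_a² + s_{a*}²) ). -/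
open MeasureTheory Real ProbabilityTheory Finset

lemma std_cdf (z : ℝ) : gaussianReal 0 1 (Set.Iic z) = ENNReal.ofReal (stdNormalCDF z) := by
  rw [gaussianReal_apply_eq_integral 0 one_ne_zero]
  congr 1
  unfold stdNormalCDF
  simp [gaussianPDFReal]

lemma stdNormalCDF_nonneg (z : ℝ) : 0 ≤ stdNormalCDF z := by
  unfold stdNormalCDF
  exact integral_nonneg fun x => by positivity

lemma gauss_neg (m σ : ℝ) (v : NNReal) (hσ : 0 < σ) (hv : (v : ℝ) = σ ^ 2) :
    gaussianReal m v (Set.Iio 0) ≤ ENNReal.ofReal (stdNormalCDF (-m / σ)) := by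
  have h1 : (gaussianReal 0 1).map (fun x => σ * x) = gaussianReal 0 v := by
    rw [gaussianReal_map_const_mul]
    congr 1
    · simp
    · ext; simp [hv]
  have h2 : (gaussianReal 0 v).map (fun x => x + m) = gaussianReal m v := by
    rw [gaussianReal_map_add_const]; simp
  rw [← h2, Measure.map_apply (by fun_prop) measurableSet_Iio, ← h1,
    Measure.map_apply (by fun_prop) (measurableSet_Iio.preimage (by fun_prop)), ← std_cdf]
  apply measure_mono
  intro x hx
  simp only [Set.mem_preimage, Set.mem_Iio, Set.mem_Iic] at *
  rw [le_div_iff₀ hσ]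
  linarith

theorem stmt_aux {A : Type*} [Fintype A] [DecidableEq A] (astar : A)
    (ν s : A → ℝ) (hs : ∀ a, 0 < s a)
    (v : A → NNReal) (hv : ∀ a, (v a : ℝ) = s a ^ 2) :
    (Measure.pi fun a => gaussianReal (ν a) (v a))
        {θ : A → ℝ | ∃ a ≠ astar, θ astar < θ a}
      ≤ ENNReal.ofReal (∑ a ∈ univ.erase astar,
          stdNormalCDF ((ν a - ν astar) / Real.sqrt ((s a) ^ 2 + (s astar) ^ 2))) := by
  rw [ENNReal.ofReal_sum_of_nonneg fun _ _ => stdNormalCDF_nonneg _]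
  set P := Measure.pi fun a => gaussianReal (ν a) (v a) with hP
  have hset : {θ : A → ℝ | ∃ a ≠ astar, θ astar < θ a}
      = ⋃ a ∈ univ.erase astar, {θ : A → ℝ | θ astar < θ a} := by
    ext θ; simp
  rw [hset]
  refine (measure_biUnion_finset_le _ _).trans (Finset.sum_le_sum fun a ha => ?_)
  have hne : a ≠ astar := (Finset.mem_erase.1 ha).1
  have hev : ∀ b, P.map (fun θ : A → ℝ => θ b)
      = gaussianReal (ν b) (v b) := fun b =>
    (measurePreserving_eval (fun a => gaussianReal (ν a) (v a)) b).map_eq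
  have hind : iIndepFun (fun (b : A) (θ : A → ℝ) => θ b) P :=
    iIndepFun_pi (X := fun _ x => x) fun _ => aemeasurable_id
  have hneg : P.map (fun θ : A → ℝ => -θ a)
      = gaussianReal (-ν a) (v a) := by
    rw [← gaussianReal_map_neg, ← hev a, Measure.map_map (by fun_prop) (by fun_prop)]
    rfl
  have hind2 : IndepFun (fun θ : A → ℝ => θ astar) (fun θ : A → ℝ => -θ a) P :=
    (hind.indepFun hne.symm).comp (φ := fun x => x) (ψ := fun x => -x)
      measurable_id measurable_neg
  have hlaw := gaussianReal_add_gaussianReal_of_indepFun hind2 (hev astar) hneg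
  have hpos : 0 < s a ^ 2 + s astar ^ 2 := by have := hs a; positivity
  have key := gauss_neg (ν astar + -ν a) (Real.sqrt (s a ^ 2 + s astar ^ 2)) (v astar + v a)
    (Real.sqrt_pos.2 hpos)
    (by rw [Real.sq_sqrt hpos.le, add_comm (s a ^ 2)]; simp [hv])
  rw [← hlaw, Measure.map_apply (by fun_prop) measurableSet_Iio] at key
  have e : -(ν astar + -ν a) = ν a - ν astar := by ring
  rw [e] at key
  refine le_trans (measure_mono ?_) key
  intro θ hθ
  simp only [Set.mem_setOf_eq, Set.mem_preimage, Set.mem_Iio, Pi.add_apply] at *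
  linarith

/-- Union bound on the probability that the target Gaussian coordinate is not the largest. -/
theorem stmt10 {A : Type*} [Fintype A] [DecidableEq A] (hA : 2 ≤ Fintype.card A) (astar : A)
    (ν s : A → ℝ) (hs : ∀ a, 0 < s a) :
    (Measure.pi fun a => gaussianReal (ν a) ⟨(s a) ^ 2, sq_nonneg (s a)⟩)
        {θ : A → ℝ | ∃ a ≠ astar, θ astar < θ a}
      ≤ ENNReal.ofReal (∑ a ∈ univ.erase astar,
          stdNormalCDF ((ν a - ν astar) / Real.sqrt ((s a) ^ 2 + (s astar) ^ 2))) := by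
  exact stmt_aux astar ν s hs (fun a => ⟨(s a) ^ 2, sq_nonneg (s a)⟩) (fun _ => rfl)
end
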